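/- arXiv:0903.4914 — 3 statements merged into one kernel-verified Lean document; each statement's English description precedes it below -/
import Mathlib

section
/- Let A be a separable C*-algebra and B ⊆ A a hereditary C*-subalgebra. If there exists a nonzero bounded tracial positive linear functional on B, i.e. a continuous linear functional τ : B → ℂ with τ ≠ 0, τ(b) ≥ 0 for every positive b ∈ B, and τ(x·y) = τ(y·x) for all x, y ∈ B, then A admits a nontrivial (possibly unbounded) lower semicontinuous trace: there exists τ' : A₊ → [0,∞] which is additive and positively homogeneous on A₊, lower semicontinuous for the norm topology, satisfies τ'(x*·x) = τ'(x·x*) for all x ∈ A, and satisfies 0 < τ'(a) < ∞ for some positive a ∈ A. -/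
open scoped ComplexOrder ENNReal

section HereditaryTrace

variable {A : Type*} [NonUnitalCStarAlgebra A] [PartialOrder A] [StarOrderedRing A]

/-- The real part of a functional on `B`, extended by zero outside `B`. -/
noncomputable def reExtend (B : NonUnitalStarSubalgebra ℂ A) (τ : B →L[ℂ] ℂ) (a : A) : ℝ :=
  open Classical in if h : a ∈ B then (τ ⟨a, h⟩).re else 0

/-- `T` restricts to a bounded positive tracial real-linear functional on `B`. -/
structure IsBoundedTraceOn (B : NonUnitalStarSubalgebra ℂ A) (T : A → ℝ) : Prop where
  map_add : ∀ b ∈ B, ∀ c ∈ B, T (b + c) = T b + T c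
  map_smul : ∀ (t : ℝ), ∀ b ∈ B, T (t • b) = t * T b
  nonneg : ∀ b ∈ B, 0 ≤ b → 0 ≤ T b
  comm : ∀ b ∈ B, ∀ c ∈ B, T (b * c) = T (c * b)
  bound : ∃ C, 0 ≤ C ∧ ∀ b ∈ B, |T b| ≤ C * ‖b‖

/-- `B` is closed under passing to smaller positive elements. -/
def IsHereditaryIn (B : NonUnitalStarSubalgebra ℂ A) : Prop :=
  ∀ a b : A, b ∈ B → 0 ≤ a → a ≤ b → a ∈ B

/-- A finite family in the closed right ideal `{x | x * star x ∈ B}` with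
`∑ i, star (x i) * x i` a contraction. -/
structure IsSubframe (B : NonUnitalStarSubalgebra ℂ A) {ι : Type*} [Fintype ι] (x : ι → A) :
    Prop where
  mem : ∀ i, x i * star (x i) ∈ B
  norm_le : ‖∑ i, star (x i) * x i‖ ≤ 1

namespace IsHereditaryIn

variable {B : NonUnitalStarSubalgebra ℂ A}

lemma mul_right (hB : IsHereditaryIn B) {x : A} (hx : x * star x ∈ B) (a : A) :
    (x * a) * star (x * a) ∈ B := by
  refine hB _ (‖a * star a‖ • (x * star x)) ?_ (mul_star_self_nonneg _) ?_
  · exact B.smul_mem ((‖a * star a‖ : ℝ) : ℂ) hx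
  · have h := CStarAlgebra.star_right_conjugate_le_norm_smul (a := x) (b := a * star a)
      (.mul_star_self a)
    simpa [mul_assoc] using h

lemma add (hB : IsHereditaryIn B) {x y : A} (hx : x * star x ∈ B) (hy : y * star y ∈ B) :
    (x + y) * star (x + y) ∈ B := by
  refine hB _ ((x * star x + y * star y) + (x * star x + y * star y))
    (add_mem (add_mem hx hy) (add_mem hx hy)) (mul_star_self_nonneg _) ?_
  rw [← sub_nonneg]
  convert mul_star_self_nonneg (x - y) using 1
  simp only [star_add, star_sub]
  noncomm_ring

omit [PartialOrder A] [StarOrderedRing A] in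
lemma smul {x : A} (hx : x * star x ∈ B) (c : ℂ) : (c • x) * star (c • x) ∈ B := by
  rw [star_smul, smul_mul_smul_comm]
  exact B.smul_mem _ hx

lemma mul_star_mem (hB : IsHereditaryIn B) {x y : A} (hx : x * star x ∈ B)
    (hy : y * star y ∈ B) : x * star y ∈ B := by
  have h (c : ℂ) := hB.add hx (smul hy c)
  have key : x * star y = (4⁻¹ : ℂ) •
      ((x + (1 : ℂ) • y) * star (x + (1 : ℂ) • y)
        - (x + (-1 : ℂ) • y) * star (x + (-1 : ℂ) • y)
        + Complex.I • ((x + Complex.I • y) * star (x + Complex.I • y))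
        - Complex.I • ((x + (-Complex.I) • y) * star (x + (-Complex.I) • y))) := by
    simp only [star_add, star_smul, mul_add, add_mul, smul_mul_assoc, mul_smul_comm, smul_add,
      smul_sub, smul_smul, RCLike.star_def, map_neg, map_one, Complex.conj_I]
    match_scalars <;> ring_nf <;> norm_num [Complex.I_sq]
  rw [key]
  exact B.smul_mem _ (sub_mem (add_mem (sub_mem (h _) (h _)) (B.smul_mem _ (h _)))
    (B.smul_mem _ (h _)))

lemma conj_mem (hB : IsHereditaryIn B) {x : A} (hx : x * star x ∈ B) (a : A) :
    x * a * star x ∈ B :=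
  hB.mul_star_mem (hB.mul_right hx a) hx

omit [PartialOrder A] [StarOrderedRing A] in
lemma mul_star_self_mem {b : A} (hb : b ∈ B) : b * star b ∈ B :=
  mul_mem hb (star_mem hb)

end IsHereditaryIn

lemma mul_star_conj_nonneg {a : A} (ha : 0 ≤ a) (x : A) : 0 ≤ x * a * star x := by
  simpa using star_left_conjugate_nonneg ha (star x)

lemma sum_star_mul_self_nonneg {ι : Type*} [Fintype ι] (x : ι → A) :
    0 ≤ ∑ i, star (x i) * x i :=
  Finset.sum_nonneg fun i _ => star_mul_self_nonneg (x i)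

lemma IsSubframe.conj_le {B : NonUnitalStarSubalgebra ℂ A} {ι : Type*} [Fintype ι] {x : ι → A}
    (hx : IsSubframe B x) (y : A) : y * (∑ i, star (x i) * x i) * star y ≤ y * star y := by
  have h0 := sum_star_mul_self_nonneg x
  refine (CStarAlgebra.star_right_conjugate_le_norm_smul (a := y) (.of_nonneg h0)).trans ?_
  rw [← sub_nonneg]
  have : y * star y - ‖∑ i, star (x i) * x i‖ • (y * star y)
      = (1 - ‖∑ i, star (x i) * x i‖) • (y * star y) := by
    rw [sub_smul, one_smul]
  rw [this]
  exact smul_nonneg (sub_nonneg.2 hx.norm_le) (mul_star_self_nonneg y)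

/-- A positive element `s` admits a self-adjoint `k` such that `k * s * k` is a contraction and
almost a unit for `s`. -/
lemma exists_approx_unit_conj {s : A} (hs0 : 0 ≤ s) {δ : ℝ} (hδ : 0 < δ) :
    ∃ k : A, star k = k ∧ ‖k * s * k‖ ≤ 1 ∧
      ‖s - k * s * k * s - (s * (k * s * k) - k * s * k * s * (k * s * k))‖ ≤ 4 * δ := by
  have hsa : IsSelfAdjoint s := .of_nonneg hs0
  have hspec : ∀ t ∈ quasispectrum ℝ s, 0 ≤ t := quasispectrum_nonneg_of_nonneg s hs0
  obtain ⟨f, hf, hf0, hft⟩ : ∃ f : ℝ → ℝ, Continuous f ∧ f 0 = 0 ∧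
      ∀ t, 0 ≤ t → f t * t * f t = (t / (t + δ)) ^ 2 := by
    refine ⟨fun t => √t / (|t| + δ), ?_, by simp, fun t ht => ?_⟩
    · have hpos (t : ℝ) : |t| + δ ≠ 0 := by positivity
      fun_prop (disch := exact hpos _)
    · have : t + δ ≠ 0 := by positivity
      simp only [abs_of_nonneg ht]
      field_simp
      rw [Real.sq_sqrt ht, sq]
  obtain ⟨g, hg, hg0, hgt, hG⟩ : ∃ g : ℝ → ℝ, Continuous g ∧ g 0 = 0 ∧
      (∀ t, 0 ≤ t → g t = (t / (t + δ)) ^ 2) ∧ cfcₙ f s * s * cfcₙ f s = cfcₙ g s := by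
    refine ⟨fun t => f t * t * f t, by fun_prop, by simp, hft, ?_⟩
    have hft' : Continuous fun t => f t * t := by fun_prop
    rw [cfcₙ_mul (fun t => f t * t) f s hft'.continuousOn (by simp) hf.continuousOn hf0,
      cfcₙ_mul f (fun t => t) s hf.continuousOn hf0 continuousOn_id rfl, cfcₙ_id' ℝ s]
  refine ⟨cfcₙ f s, (cfcₙ_predicate f s : IsSelfAdjoint _), ?_, ?_⟩
  · rw [hG]
    refine norm_cfcₙ_le fun t ht => ?_
    have ht0 := hspec t ht
    rw [hgt t ht0, Real.norm_of_nonneg (by positivity)]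
    exact pow_le_one₀ (by positivity) ((div_le_one (by positivity)).2 (by linarith))
  · have hgid : Continuous fun t => g t * t := by fun_prop
    have hidg : Continuous fun t => t * g t := by fun_prop
    have hgg : Continuous fun t => g t * t * g t := by fun_prop
    have h1 : Continuous fun t => t - g t * t := by fun_prop
    have h2 : Continuous fun t => t * g t - g t * t * g t := by fun_prop
    have hcfc : s - cfcₙ g s * s - (s * cfcₙ g s - cfcₙ g s * s * cfcₙ g s)
        = cfcₙ (fun t => t - g t * t - (t * g t - g t * t * g t)) s := by
      rw [cfcₙ_sub (fun t => t - g t * t) (fun t => t * g t - g t * t * g t) s h1.continuousOn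
          (by simp) h2.continuousOn (by simp),
        cfcₙ_sub (fun t => t) (fun t => g t * t) s continuousOn_id rfl hgid.continuousOn (by simp),
        cfcₙ_sub (fun t => t * g t) (fun t => g t * t * g t) s hidg.continuousOn (by simp)
          hgg.continuousOn (by simp),
        cfcₙ_mul (fun t => g t * t) g s hgid.continuousOn (by simp) hg.continuousOn hg0,
        cfcₙ_mul g (fun t => t) s hg.continuousOn hg0 continuousOn_id rfl,
        cfcₙ_mul (fun t => t) g s continuousOn_id rfl hg.continuousOn hg0, cfcₙ_id' ℝ s]
    rw [hG, hcfc]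
    refine norm_cfcₙ_le fun t ht => ?_
    have ht0 := hspec t ht
    have hD : 0 < t + δ := by positivity
    have e : t - g t * t - (t * g t - g t * t * g t) = t * (1 - g t) ^ 2 := by ring
    have e1 : 1 - g t = (δ / (t + δ)) * (1 + t / (t + δ)) := by
      rw [hgt t ht0]; field_simp; ring
    have h2 : t / (t + δ) ≤ 1 := (div_le_one hD).2 (by linarith)
    have h3 : 0 ≤ t / (t + δ) := by positivity
    have h4 : δ / (t + δ) ≤ 1 := (div_le_one hD).2 (by linarith)
    have h5 : 0 ≤ δ / (t + δ) := by positivity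
    have e2 : t * (1 - g t) ^ 2
        = δ * ((t / (t + δ)) * (δ / (t + δ)) * (1 + t / (t + δ)) ^ 2) := by
      rw [e1]; field_simp
    rw [e, Real.norm_of_nonneg (by positivity), e2, mul_comm 4 δ]
    gcongr
    have h6 : (t / (t + δ)) * (δ / (t + δ)) ≤ 1 := mul_le_one₀ h2 h5 h4
    have h7 : (1 + t / (t + δ)) ^ 2 ≤ 4 := by nlinarith
    simpa using mul_le_mul h6 h7 (by positivity) zero_le_one

/-- Subframes act as approximate right units on finite subsets of the ideal
`{x | x * star x ∈ B}`. -/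
lemma IsHereditaryIn.exists_subframe {B : NonUnitalStarSubalgebra ℂ A} (hB : IsHereditaryIn B)
    {ι : Type*} [Fintype ι] (w : ι → A) (hw : ∀ i, w i * star (w i) ∈ B) {η : ℝ} (hη : 0 < η) :
    ∃ z : ι → A, IsSubframe B z ∧ ∀ i, ‖w i - w i * ∑ j, star (z j) * z j‖ ≤ η := by
  set s := ∑ i, star (w i) * w i with hs
  obtain ⟨k, hk, hk1, hk2⟩ :=
    exists_approx_unit_conj (sum_star_mul_self_nonneg w) (δ := η ^ 2 / 4) (by positivity)
  rw [← hs] at hk1 hk2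
  have hsa : star s = s := (IsSelfAdjoint.of_nonneg (sum_star_mul_self_nonneg w))
  have hG : ∑ j, star (w j * k) * (w j * k) = k * s * k := by
    simp only [hs, Finset.mul_sum, Finset.sum_mul, star_mul, hk, mul_assoc]
  refine ⟨fun j => w j * k, ⟨fun i => hB.mul_right (hw i) k, by rwa [hG]⟩, fun i => ?_⟩
  rw [hG]
  set G := k * s * k with hGdef
  have hGsa : star G = G := by simp only [hGdef, star_mul, hk, hsa, mul_assoc]
  have hsum : ∑ j, star (w j - w j * G) * (w j - w j * G) = s - G * s - (s * G - G * s * G) := by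
    simp only [hs, Finset.mul_sum, Finset.sum_mul, ← Finset.sum_sub_distrib]
    refine Finset.sum_congr rfl fun j _ => ?_
    simp only [star_sub, star_mul, hGsa]
    noncomm_ring
  have hle : star (w i - w i * G) * (w i - w i * G)
      ≤ ∑ j, star (w j - w j * G) * (w j - w j * G) :=
    Finset.single_le_sum (f := fun j => star (w j - w j * G) * (w j - w j * G))
      (fun j _ => star_mul_self_nonneg _) (Finset.mem_univ i)
  have hnorm : ‖w i - w i * G‖ * ‖w i - w i * G‖ ≤ η ^ 2 := by
    rw [← CStarRing.norm_star_mul_self]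
    refine (CStarAlgebra.norm_le_norm_of_nonneg_of_le (star_mul_self_nonneg _) hle).trans ?_
    rw [hsum]
    linarith
  nlinarith [norm_nonneg (w i - w i * G)]

/-- Compression of `T` by a finite family `x`. -/
noncomputable def compress (T : A → ℝ) {ι : Type*} [Fintype ι] (x : ι → A) (a : A) : ℝ :=
  ∑ i, T (x i * a * star (x i))

namespace IsBoundedTraceOn

variable {B : NonUnitalStarSubalgebra ℂ A} {T : A → ℝ}

omit [StarOrderedRing A] in
lemma map_zero (hT : IsBoundedTraceOn B T) : T 0 = 0 := by
  simpa using hT.map_smul 0 0 (zero_mem B)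

omit [StarOrderedRing A] in
lemma map_sub (hT : IsBoundedTraceOn B T) {b c : A} (hb : b ∈ B) (hc : c ∈ B) :
    T (b - c) = T b - T c := by
  have := hT.map_add (b - c) (sub_mem hb hc) c hc
  rw [sub_add_cancel] at this
  linarith

omit [StarOrderedRing A] in
lemma map_sum (hT : IsBoundedTraceOn B T) {ι : Type*} (s : Finset ι) (b : ι → A)
    (hb : ∀ i, b i ∈ B) : T (∑ i ∈ s, b i) = ∑ i ∈ s, T (b i) := by
  classical
  induction s using Finset.induction_on with
  | empty => simpa using hT.map_zero
  | insert i s hi ih =>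
    rw [Finset.sum_insert hi, Finset.sum_insert hi,
      hT.map_add _ (hb i) _ (sum_mem fun i _ => hb i), ih]

lemma mono (hT : IsBoundedTraceOn B T) {b c : A} (hb : b ∈ B) (hc : c ∈ B) (h : b ≤ c) :
    T b ≤ T c := by
  have := hT.nonneg (c - b) (sub_mem hc hb) (sub_nonneg.2 h)
  rw [hT.map_sub hc hb] at this
  linarith

variable {ι κ : Type*} [Fintype ι] [Fintype κ]

lemma compress_add (hB : IsHereditaryIn B) (hT : IsBoundedTraceOn B T) {x : ι → A}
    (hx : ∀ i, x i * star (x i) ∈ B) (a b : A) :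
    compress T x (a + b) = compress T x a + compress T x b := by
  simp only [compress, ← Finset.sum_add_distrib]
  refine Finset.sum_congr rfl fun i _ => ?_
  rw [mul_add, add_mul, hT.map_add _ (hB.conj_mem (hx i) a) _ (hB.conj_mem (hx i) b)]

lemma compress_smul (hB : IsHereditaryIn B) (hT : IsBoundedTraceOn B T) {x : ι → A}
    (hx : ∀ i, x i * star (x i) ∈ B) (t : ℝ) (a : A) :
    compress T x (t • a) = t * compress T x a := by
  simp only [compress, Finset.mul_sum]
  refine Finset.sum_congr rfl fun i _ => ?_
  rw [mul_smul_comm, smul_mul_assoc, hT.map_smul _ _ (hB.conj_mem (hx i) a)]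

lemma compress_nonneg (hB : IsHereditaryIn B) (hT : IsBoundedTraceOn B T) {x : ι → A}
    (hx : ∀ i, x i * star (x i) ∈ B) {a : A} (ha : 0 ≤ a) : 0 ≤ compress T x a :=
  Finset.sum_nonneg fun i _ =>
    hT.nonneg _ (hB.conj_mem (hx i) a) (mul_star_conj_nonneg ha (x i))

lemma continuous_conj (hB : IsHereditaryIn B) (hT : IsBoundedTraceOn B T) {x : A}
    (hx : x * star x ∈ B) : Continuous fun a => T (x * a * star x) := by
  obtain ⟨C, hC, hb⟩ := hT.bound
  refine (LipschitzWith.of_dist_le_mul (K := (C * (‖x‖ * ‖x‖)).toNNReal) fun a b => ?_).continuous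
  rw [Real.coe_toNNReal _ (by positivity), Real.dist_eq, dist_eq_norm,
    ← hT.map_sub (hB.conj_mem hx a) (hB.conj_mem hx b), ← sub_mul, ← mul_sub]
  calc _ ≤ C * ‖x * (a - b) * star x‖ := hb _ (hB.conj_mem hx _)
    _ ≤ C * (‖x‖ * ‖a - b‖ * ‖x‖) := by
        gcongr
        refine (norm_mul_le _ _).trans ?_
        rw [norm_star]
        gcongr
        exact norm_mul_le _ _
    _ = _ := by ring

lemma continuous_compress (hB : IsHereditaryIn B) (hT : IsBoundedTraceOn B T) {x : ι → A}
    (hx : ∀ i, x i * star (x i) ∈ B) : Continuous (compress T x) :=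
  continuous_finsetSum _ fun i _ => hT.continuous_conj hB (hx i)

lemma mul_star_comm (hB : IsHereditaryIn B) (hT : IsBoundedTraceOn B T) {x y : A}
    (hx : x * star x ∈ B) (hy : y * star y ∈ B) :
    T (x * (star y * y) * star x) = T (y * (star x * x) * star y) := by
  simpa only [mul_assoc] using
    hT.comm _ (hB.mul_star_mem hx hy) _ (hB.mul_star_mem hy hx)

/-- Compressing by `x` after cutting down by a second family `z` is dominated by `z`. -/
lemma sum_conj_le_compress (hB : IsHereditaryIn B) (hT : IsBoundedTraceOn B T) {x : ι → A}
    {z : κ → A} (hx : IsSubframe B x) (hz : ∀ j, z j * star (z j) ∈ B) (y : A) :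
    ∑ i, T (x i * star y * (∑ j, star (z j) * z j) * star (x i * star y))
      ≤ compress T z (y * star y) := by
  have hxy (i : ι) := hB.mul_right (hx.mem i) (star y)
  calc _ = ∑ i, ∑ j, T (x i * star y * (star (z j) * z j) * star (x i * star y)) := by
        refine Finset.sum_congr rfl fun i _ => ?_
        rw [Finset.mul_sum, Finset.sum_mul, hT.map_sum _ _ fun j => hB.conj_mem (hxy i) _]
    _ = ∑ j, ∑ i, T (z j * (star (x i * star y) * (x i * star y)) * star (z j)) := by
        rw [Finset.sum_comm]
        exact Finset.sum_congr rfl fun j _ => Finset.sum_congr rfl fun i _ =>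
          hT.mul_star_comm hB (hxy i) (hz j)
    _ = ∑ j, T (z j * y * (∑ i, star (x i) * x i) * star (z j * y)) := by
        refine Finset.sum_congr rfl fun j _ => ?_
        rw [← hT.map_sum _ _ fun i => hB.conj_mem (hz j) _]
        simp only [Finset.mul_sum, Finset.sum_mul, star_mul, star_star, mul_assoc]
    _ ≤ ∑ j, T (z j * y * star (z j * y)) :=
        Finset.sum_le_sum fun j _ => hT.mono (hB.conj_mem (hB.mul_right (hz j) y) _)
          (hB.mul_right (hz j) y) (hx.conj_le _)
    _ = _ := by simp only [compress, star_mul, mul_assoc]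

/-- For `w` in a finite subset of the ideal, some subframe nearly recovers `T (w * star w)`. -/
lemma exists_subframe_approx (hB : IsHereditaryIn B) (hT : IsBoundedTraceOn B T) (w : ι → A)
    (hw : ∀ i, w i * star (w i) ∈ B) {ε : ℝ} (hε : 0 < ε) :
    ∃ z : ι → A, IsSubframe B z ∧
      ∀ i, T (w i * star (w i)) ≤ T (w i * (∑ j, star (z j) * z j) * star (w i)) + ε := by
  obtain ⟨C, hC, hb⟩ := hT.bound
  set M := ∑ i, ‖w i‖ with hM
  have hM0 : 0 ≤ M := Finset.sum_nonneg fun i _ => norm_nonneg _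
  obtain ⟨z, hz, hzw⟩ := hB.exists_subframe w hw (η := ε / (C * M + 1)) (by positivity)
  refine ⟨z, hz, fun i => ?_⟩
  have hwi : ‖w i‖ ≤ M :=
    Finset.single_le_sum (f := fun i => ‖w i‖) (fun i _ => norm_nonneg _) (Finset.mem_univ i)
  rw [← sub_le_iff_le_add', ← hT.map_sub (hw i) (hB.conj_mem (hw i) _), ← sub_mul]
  have hmem : (w i - w i * ∑ j, star (z j) * z j) * star (w i) ∈ B := by
    rw [sub_mul]
    exact sub_mem (hw i) (hB.conj_mem (hw i) _)
  calc _ ≤ C * ‖(w i - w i * ∑ j, star (z j) * z j) * star (w i)‖ :=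
        (le_abs_self _).trans (hb _ hmem)
    _ ≤ C * (ε / (C * M + 1) * M) := by
        gcongr
        refine (norm_mul_le _ _).trans ?_
        rw [norm_star]
        gcongr
        exact hzw i
    _ = ε * (C * M / (C * M + 1)) := by ring
    _ ≤ ε * 1 := by
        gcongr
        exact (div_le_one (by positivity)).2 (by linarith)
    _ = ε := mul_one ε

/-- Two subframes are nearly dominated by a common third one. -/
lemma exists_compress_le (hB : IsHereditaryIn B) (hT : IsBoundedTraceOn B T) {x : ι → A}
    {x' : κ → A} (hx : IsSubframe B x) (hx' : IsSubframe B x') (y y' : A) {ε : ℝ} (hε : 0 < ε) :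
    ∃ z : ι ⊕ κ → A, IsSubframe B z ∧
      compress T x (star y * y) ≤ compress T z (y * star y) + ε ∧
      compress T x' (star y' * y') ≤ compress T z (y' * star y') + ε := by
  set N : ℝ := Fintype.card ι + Fintype.card κ + 1 with hN
  have hN0 : 0 < N := by positivity
  have hι : (Fintype.card ι : ℝ) * (ε / N) ≤ ε := by
    rw [mul_div_left_comm]
    refine mul_le_of_le_one_right hε.le ((div_le_one hN0).2 ?_)
    rw [hN, add_assoc]
    exact le_add_of_nonneg_right (by positivity)
  have hκ : (Fintype.card κ : ℝ) * (ε / N) ≤ ε := by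
    rw [mul_div_left_comm]
    refine mul_le_of_le_one_right hε.le ((div_le_one hN0).2 ?_)
    have : (0 : ℝ) ≤ Fintype.card ι := by positivity
    linarith
  obtain ⟨z, hz, hzw⟩ := hT.exists_subframe_approx hB
    (Sum.elim (fun i => x i * star y) (fun j => x' j * star y'))
    (by rintro (i | j)
        · exact hB.mul_right (hx.mem i) _
        · exact hB.mul_right (hx'.mem j) _) (div_pos hε hN0)
  refine ⟨z, hz, ?_, ?_⟩
  · calc _ = ∑ i, T (x i * star y * star (x i * star y)) := by
          simp only [compress, star_mul, star_star, mul_assoc]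
      _ ≤ ∑ i, (T (x i * star y * (∑ j, star (z j) * z j) * star (x i * star y)) + ε / N) :=
          Finset.sum_le_sum fun i _ => hzw (.inl i)
      _ ≤ _ := by
          rw [Finset.sum_add_distrib, Finset.sum_const, nsmul_eq_mul, Finset.card_univ]
          exact add_le_add (hT.sum_conj_le_compress hB hx hz.mem y) hι
  · calc _ = ∑ i, T (x' i * star y' * star (x' i * star y')) := by
          simp only [compress, star_mul, star_star, mul_assoc]
      _ ≤ ∑ i, (T (x' i * star y' * (∑ j, star (z j) * z j) * star (x' i * star y')) + ε / N) :=
          Finset.sum_le_sum fun i _ => hzw (.inr i)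
      _ ≤ _ := by
          rw [Finset.sum_add_distrib, Finset.sum_const, nsmul_eq_mul, Finset.card_univ]
          exact add_le_add (hT.sum_conj_le_compress hB hx' hz.mem y') hκ

lemma compress_mul_star_le (hB : IsHereditaryIn B) (hT : IsBoundedTraceOn B T) {x : ι → A}
    (hx : IsSubframe B x) {c : A} (hc : c ∈ B) :
    compress T x (c * star c) ≤ T (star c * c) := by
  have hc' : star c * star (star c) ∈ B := IsHereditaryIn.mul_star_self_mem (star_mem hc)
  calc _ = ∑ i, T (star c * (star (x i) * x i) * star (star c)) := by
        refine Finset.sum_congr rfl fun i _ => ?_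
        simpa using hT.mul_star_comm hB (hx.mem i) hc'
    _ = T (star c * (∑ i, star (x i) * x i) * star (star c)) := by
        rw [← hT.map_sum _ _ fun i => hB.conj_mem hc' _]
        simp only [Finset.mul_sum, Finset.sum_mul]
    _ ≤ T (star c * star (star c)) := hT.mono (hB.conj_mem hc' _) hc' (hx.conj_le _)
    _ = _ := by rw [star_star]

lemma exists_le_compress (hB : IsHereditaryIn B) (hT : IsBoundedTraceOn B T) {c : A} (hc : c ∈ B)
    {ε : ℝ} (hε : 0 < ε) :
    ∃ z : Unit → A, IsSubframe B z ∧ T (star c * c) ≤ compress T z (c * star c) + ε := by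
  have hc' : star c * star (star c) ∈ B := IsHereditaryIn.mul_star_self_mem (star_mem hc)
  obtain ⟨z, hz, hzc⟩ := hT.exists_subframe_approx hB (fun _ : Unit => star c) (fun _ => hc') hε
  refine ⟨z, hz, ?_⟩
  have h := hzc ()
  have h' := hT.mul_star_comm hB hc' (hz.mem ())
  simp only [Finset.univ_unique, Finset.sum_singleton, star_star] at h h'
  rw [h'] at h
  simpa [compress] using h

end IsBoundedTraceOn

/-- Bundled subframes. -/
structure Subframe (B : NonUnitalStarSubalgebra ℂ A) where
  /-- The index type. -/
  ι : Type
  /-- The index type is finite. -/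
  [fintype : Fintype ι]
  /-- The family. -/
  toFun : ι → A
  isSubframe : IsSubframe B toFun

attribute [instance] Subframe.fintype

instance (B : NonUnitalStarSubalgebra ℂ A) : Nonempty (Subframe B) :=
  ⟨⟨Empty, Empty.elim, ⟨fun i => i.elim, by simp⟩⟩⟩

/-- The supremum of the compressions of `T` over all subframes. -/
noncomputable def traceExtension (B : NonUnitalStarSubalgebra ℂ A) (T : A → ℝ) (a : A) : ℝ≥0∞ :=
  ⨆ F : Subframe B, ENNReal.ofReal (compress T F.toFun a)

variable {B : NonUnitalStarSubalgebra ℂ A} {T : A → ℝ}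

omit [PartialOrder A] [StarOrderedRing A] in
lemma IsSubframe.le_traceExtension {ι : Type} [Fintype ι] {x : ι → A}
    (hx : IsSubframe B x) (T : A → ℝ) (a : A) :
    ENNReal.ofReal (compress T x a) ≤ traceExtension B T a :=
  le_iSup (fun F : Subframe B => ENNReal.ofReal (compress T F.toFun a)) ⟨ι, x, hx⟩

namespace IsBoundedTraceOn

lemma traceExtension_star_mul_le (hB : IsHereditaryIn B) (hT : IsBoundedTraceOn B T) (y : A) :
    traceExtension B T (star y * y) ≤ traceExtension B T (y * star y) := by
  refine iSup_le fun F => ENNReal.le_of_forall_pos_le_add fun ε hε _ => ?_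
  obtain ⟨z, hz, h, -⟩ := hT.exists_compress_le hB F.isSubframe F.isSubframe y y (ε := ε) hε
  calc _ ≤ ENNReal.ofReal (compress T z (y * star y) + ε) := ENNReal.ofReal_le_ofReal h
    _ ≤ ENNReal.ofReal (compress T z (y * star y)) + ENNReal.ofReal ε := ENNReal.ofReal_add_le
    _ ≤ _ := by
      rw [ENNReal.ofReal_coe_nnreal]
      gcongr
      exact hz.le_traceExtension T _

lemma traceExtension_add_le (hB : IsHereditaryIn B) (hT : IsBoundedTraceOn B T) (a b : A) :
    traceExtension B T (a + b) ≤ traceExtension B T a + traceExtension B T b := by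
  refine iSup_le fun F => ?_
  rw [hT.compress_add hB F.isSubframe.mem]
  refine ENNReal.ofReal_add_le.trans ?_
  gcongr <;> exact F.isSubframe.le_traceExtension T _

lemma traceExtension_add (hB : IsHereditaryIn B) (hT : IsBoundedTraceOn B T) {a b : A}
    (ha : 0 ≤ a) (hb : 0 ≤ b) :
    traceExtension B T (a + b) = traceExtension B T a + traceExtension B T b := by
  have hsqrt {a : A} (ha : 0 ≤ a) : ∃ y : A, star y * y = a ∧ y * star y = a := by
    have h : star (CFC.sqrt a) = CFC.sqrt a := (IsSelfAdjoint.of_nonneg (CFC.sqrt_nonneg a))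
    exact ⟨CFC.sqrt a, by rw [h, CFC.sqrt_mul_sqrt_self a ha],
      by rw [h, CFC.sqrt_mul_sqrt_self a ha]⟩
  refine le_antisymm (hT.traceExtension_add_le hB a b) ?_
  conv_lhs => simp only [traceExtension, ENNReal.iSup_add, ENNReal.add_iSup]
  refine iSup_le fun F' => iSup_le fun F => ENNReal.le_of_forall_pos_le_add fun ε hε _ => ?_
  obtain ⟨y, hy, hy'⟩ := hsqrt ha
  obtain ⟨y', h1, h2⟩ := hsqrt hb
  have hε2 : (0 : ℝ) < ε / 2 := half_pos hε
  obtain ⟨z, hz, h, h'⟩ := hT.exists_compress_le hB F.isSubframe F'.isSubframe y y' hε2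
  rw [hy, hy'] at h
  rw [h1, h2] at h'
  rw [← ENNReal.ofReal_add (hT.compress_nonneg hB F.isSubframe.mem ha)
    (hT.compress_nonneg hB F'.isSubframe.mem hb)]
  calc _ ≤ ENNReal.ofReal (compress T z (a + b) + ε) := by
        rw [hT.compress_add hB hz.mem]
        exact ENNReal.ofReal_le_ofReal (by linarith)
    _ ≤ ENNReal.ofReal (compress T z (a + b)) + ENNReal.ofReal ε := ENNReal.ofReal_add_le
    _ ≤ _ := by
      rw [ENNReal.ofReal_coe_nnreal]
      gcongr
      exact hz.le_traceExtension T _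

lemma traceExtension_smul (hB : IsHereditaryIn B) (hT : IsBoundedTraceOn B T) {t : ℝ}
    (ht : 0 ≤ t) (a : A) :
    traceExtension B T (t • a) = ENNReal.ofReal t * traceExtension B T a := by
  simp only [traceExtension, ENNReal.mul_iSup]
  exact iSup_congr fun F => by
    rw [hT.compress_smul hB F.isSubframe.mem, ENNReal.ofReal_mul ht]

lemma lowerSemicontinuous_traceExtension (hB : IsHereditaryIn B) (hT : IsBoundedTraceOn B T) :
    LowerSemicontinuous (traceExtension B T) :=
  lowerSemicontinuous_iSup fun F => (ENNReal.continuous_ofReal.comp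
    (hT.continuous_compress hB F.isSubframe.mem)).lowerSemicontinuous

lemma traceExtension_mul_star_le (hB : IsHereditaryIn B) (hT : IsBoundedTraceOn B T) {c : A}
    (hc : c ∈ B) : traceExtension B T (c * star c) ≤ ENNReal.ofReal (T (star c * c)) :=
  iSup_le fun F => ENNReal.ofReal_le_ofReal (hT.compress_mul_star_le hB F.isSubframe hc)

lemma traceExtension_mul_star_pos (hB : IsHereditaryIn B) (hT : IsBoundedTraceOn B T) {c : A}
    (hc : c ∈ B) (h : 0 < T (star c * c)) : 0 < traceExtension B T (c * star c) := by
  obtain ⟨z, hz, hzc⟩ := hT.exists_le_compress hB hc (half_pos h)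
  exact (ENNReal.ofReal_pos.2 (by linarith)).trans_le (hz.le_traceExtension T _)

end IsBoundedTraceOn

omit [PartialOrder A] [StarOrderedRing A] in
lemma reExtend_of_mem (τ : B →L[ℂ] ℂ) {b : A} (hb : b ∈ B) :
    reExtend B τ b = (τ ⟨b, hb⟩).re := dif_pos hb

omit [StarOrderedRing A] in
lemma isBoundedTraceOn_reExtend (τ : B →L[ℂ] ℂ) (hτpos : ∀ b : B, 0 ≤ (b : A) → 0 ≤ τ b)
    (hτtr : ∀ x y : B, τ (x * y) = τ (y * x)) : IsBoundedTraceOn B (reExtend B τ) where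
  map_add b hb c hc := by
    rw [reExtend_of_mem τ hb, reExtend_of_mem τ hc, reExtend_of_mem τ (add_mem hb hc),
      ← Complex.add_re, ← map_add]
    rfl
  map_smul t b hb := by
    have h : t • b ∈ B := B.smul_mem (t : ℂ) hb
    have h' : (⟨t • b, h⟩ : B) = (t : ℂ) • ⟨b, hb⟩ := rfl
    rw [reExtend_of_mem τ hb, reExtend_of_mem τ h, h', map_smul, smul_eq_mul, Complex.re_ofReal_mul]
  nonneg b hb h := by
    rw [reExtend_of_mem τ hb]
    exact (Complex.nonneg_iff.1 (hτpos ⟨b, hb⟩ h)).1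
  comm b hb c hc := by
    rw [reExtend_of_mem τ (mul_mem hb hc), reExtend_of_mem τ (mul_mem hc hb)]
    exact congrArg Complex.re (hτtr ⟨b, hb⟩ ⟨c, hc⟩)
  bound := ⟨‖τ‖, τ.opNorm_nonneg, fun b hb => by
    rw [reExtend_of_mem τ hb]
    exact (Complex.abs_re_le_norm _).trans (τ.le_opNorm ⟨b, hb⟩)⟩

omit [PartialOrder A] [StarOrderedRing A] in
/-- A self-adjoint element of a closed subalgebra is a difference of two squares of self-adjoint
elements of that subalgebra. -/
lemma exists_sq_sub_sq (hBclosed : IsClosed (B : Set A)) {h : A} (hh : IsSelfAdjoint h)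
    (hhB : h ∈ B) : ∃ c ∈ B, ∃ d ∈ B, h = star c * c - star d * d := by
  have hp : Continuous fun t : ℝ => √t := by fun_prop
  have hn : Continuous fun t : ℝ => √(-t) := by fun_prop
  have hpp : Continuous fun t : ℝ => √t * √t := by fun_prop
  have hnn : Continuous fun t : ℝ => √(-t) * √(-t) := by fun_prop
  have hc : star (cfcₙ (fun t : ℝ => √t) h) = cfcₙ (fun t : ℝ => √t) h :=
    (cfcₙ_predicate _ h : IsSelfAdjoint _)
  have hd : star (cfcₙ (fun t : ℝ => √(-t)) h) = cfcₙ (fun t : ℝ => √(-t)) h :=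
    (cfcₙ_predicate _ h : IsSelfAdjoint _)
  refine ⟨cfcₙ (fun t : ℝ => √t) h, cfcₙ_mem (hs := hBclosed) (𝕜' := ℂ) _ hhB,
    cfcₙ (fun t : ℝ => √(-t)) h, cfcₙ_mem (hs := hBclosed) (𝕜' := ℂ) _ hhB, ?_⟩
  rw [hc, hd, ← cfcₙ_mul _ _ h hp.continuousOn (by simp) hp.continuousOn (by simp),
    ← cfcₙ_mul _ _ h hn.continuousOn (by simp) hn.continuousOn (by simp),
    ← cfcₙ_sub _ _ h hpp.continuousOn (by simp) hnn.continuousOn (by simp)]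
  conv_lhs => rw [← cfcₙ_id' ℝ h]
  refine cfcₙ_congr fun t _ => ?_
  rcases le_total 0 t with ht | ht
  · simp [Real.mul_self_sqrt ht, Real.sqrt_eq_zero_of_nonpos (neg_nonpos.2 ht)]
  · simp [Real.mul_self_sqrt (neg_nonneg.2 ht), Real.sqrt_eq_zero_of_nonpos ht]

lemma exists_pos_of_ne_zero (hBclosed : IsClosed (B : Set A)) (τ : B →L[ℂ] ℂ) (hτne : τ ≠ 0)
    (hτpos : ∀ b : B, 0 ≤ (b : A) → 0 ≤ τ b) :
    ∃ c ∈ B, 0 < reExtend B τ (star c * c) := by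
  by_contra! H
  have hsq (c : B) : τ (star c * c) = 0 := by
    have h := Complex.nonneg_iff.1 (hτpos (star c * c) (star_mul_self_nonneg (c : A)))
    have h' := H c c.2
    rw [reExtend_of_mem τ (mul_mem (star_mem c.2) c.2)] at h'
    exact Complex.ext (le_antisymm h' h.1) h.2.symm
  have hsa (b : B) (hb : IsSelfAdjoint (b : A)) : τ b = 0 := by
    obtain ⟨c, hc, d, hd, h⟩ := exists_sq_sub_sq hBclosed hb b.2
    have : b = star (⟨c, hc⟩ : B) * ⟨c, hc⟩ - star (⟨d, hd⟩ : B) * ⟨d, hd⟩ := Subtype.ext h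
    rw [this, map_sub, hsq, hsq, sub_zero]
  refine hτne (ContinuousLinearMap.ext fun b => ?_)
  have h1 := hsa (b + star b) (IsSelfAdjoint.add_star_self (b : A))
  have h2 := hsa (Complex.I • (b - star b)) (by
    simp [IsSelfAdjoint, star_smul, ← smul_neg])
  rw [map_add] at h1
  rw [map_smul, smul_eq_mul, mul_eq_zero, or_iff_right Complex.I_ne_zero, map_sub] at h2
  have : 2 * τ b = 0 := by linear_combination h1 + h2
  simpa using this

end HereditaryTrace

/-- Let `A` be a separable C*-algebra and `B ⊆ A` a hereditary
C*-subalgebra. If `B` carries a nonzero bounded positive tracial linear functional, then `A`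
admits a nontrivial (possibly unbounded) lower semicontinuous trace. -/
theorem bounded_trace_on_hereditary_extends {A : Type*} [NonUnitalCStarAlgebra A]
    [PartialOrder A] [StarOrderedRing A] [TopologicalSpace.SeparableSpace A]
    (B : NonUnitalStarSubalgebra ℂ A) (hBclosed : IsClosed (B : Set A))
    (hBher : ∀ a b : A, b ∈ B → 0 ≤ a → a ≤ b → a ∈ B)
    (τ : B →L[ℂ] ℂ) (hτne : τ ≠ 0)
    (hτpos : ∀ b : B, 0 ≤ (b : A) → 0 ≤ τ b)
    (hτtr : ∀ x y : B, τ (x * y) = τ (y * x)) :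
    ∃ τ' : A → ℝ≥0∞,
      (∀ a b : A, 0 ≤ a → 0 ≤ b → τ' (a + b) = τ' a + τ' b) ∧
      (∀ (t : ℝ) (a : A), 0 < t → 0 ≤ a → τ' (t • a) = ENNReal.ofReal t * τ' a) ∧
      τ' 0 = 0 ∧
      LowerSemicontinuousOn τ' {a : A | 0 ≤ a} ∧
      (∀ x : A, τ' (star x * x) = τ' (x * star x)) ∧
      (∃ a : A, 0 ≤ a ∧ 0 < τ' a ∧ τ' a < ∞) := by
  have hB : IsHereditaryIn B := hBher
  have hT := isBoundedTraceOn_reExtend τ hτpos hτtr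
  obtain ⟨c, hc, hpos⟩ := exists_pos_of_ne_zero hBclosed τ hτne hτpos
  refine ⟨traceExtension B (reExtend B τ), fun a b ha hb => hT.traceExtension_add hB ha hb,
    fun t a ht _ => hT.traceExtension_smul hB ht.le a, ?_,
    (hT.lowerSemicontinuous_traceExtension hB).lowerSemicontinuousOn _, fun x => ?_,
    c * star c, mul_star_self_nonneg c, hT.traceExtension_mul_star_pos hB hc hpos,
    (hT.traceExtension_mul_star_le hB hc).trans_lt ENNReal.ofReal_lt_top⟩
  · simpa using hT.traceExtension_smul hB le_rfl (0 : A)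
  · refine le_antisymm (hT.traceExtension_star_mul_le hB x) ?_
    simpa using hT.traceExtension_star_mul_le hB (star x)
end

section
/- Let A be a separable C*-algebra admitting no nontrivial lower semicontinuous trace, i.e. there is no function τ : A₊ → [0,∞] which is additive and positively homogeneous on the positive cone, lower semicontinuous for the norm topology, satisfies τ(x*·x) = τ(x·x*) for all x ∈ A, and takes a finite nonzero value on some positive element. Then no hereditary C*-subalgebra of A has a finite-dimensional irreducible representation; equivalently, for every hereditary C*-subalgebra B ⊆ A and every k ≥ 1 there is no surjective star-algebra homomorphism from B onto the matrix algebra M_k(ℂ). -/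
open scoped ENNReal

open scoped InnerProductSpace in
/-- Parseval's identity. -/
lemma HilbertBasis.tsum_ofReal_norm_inner_sq {ι H : Type*} [NormedAddCommGroup H]
    [InnerProductSpace ℂ H] (e : HilbertBasis ι ℂ H) (x : H) :
    ∑' i, ENNReal.ofReal (‖⟪e i, x⟫_ℂ‖ ^ 2) = ENNReal.ofReal (‖x‖ ^ 2) := by
  have h : HasSum (fun i ↦ ‖⟪e i, x⟫_ℂ‖ ^ 2) (‖x‖ ^ 2) := by
    have := (e.hasSum_inner_mul_inner x x).mapL Complex.reCLM
    convert this using 1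
    · ext i
      rw [← inner_conj_symm x (e i), ← Complex.normSq_eq_conj_mul_self]
      simp [Complex.normSq_eq_norm_sq, -Complex.ofReal_pow]
    · simp [inner_self_eq_norm_sq_to_K, ← Complex.ofReal_pow]
  rw [← ENNReal.ofReal_tsum_of_nonneg (fun _ ↦ by positivity) h.summable, h.tsum_eq]

/-- The Hilbert–Schmidt norm of an operator equals that of its adjoint. -/
lemma HilbertBasis.tsum_ofReal_norm_sq_eq_adjoint {ι κ H K : Type*}
    [NormedAddCommGroup H] [InnerProductSpace ℂ H] [CompleteSpace H]
    [NormedAddCommGroup K] [InnerProductSpace ℂ K] [CompleteSpace K]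
    (e : HilbertBasis ι ℂ H) (f : HilbertBasis κ ℂ K) (T : H →L[ℂ] K) :
    ∑' i, ENNReal.ofReal (‖T (e i)‖ ^ 2) =
      ∑' j, ENNReal.ofReal (‖ContinuousLinearMap.adjoint T (f j)‖ ^ 2) := by
  simp_rw [← f.tsum_ofReal_norm_inner_sq (T _), ← e.tsum_ofReal_norm_inner_sq
    (ContinuousLinearMap.adjoint T _), ContinuousLinearMap.adjoint_inner_right]
  rw [ENNReal.tsum_comm]
  simp_rw [norm_inner_symm]

open scoped InnerProductSpace in
/-- A representation on a Hilbert space induces a lower semicontinuous trace by composing it with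
the operator trace. -/
lemma exists_lsc_trace_of_representation {A H ι : Type*} [NonUnitalCStarAlgebra A] [PartialOrder A]
    [StarOrderedRing A] [NormedAddCommGroup H] [InnerProductSpace ℂ H] [CompleteSpace H]
    (e : HilbertBasis ι ℂ H) (ρ : A →⋆ₙₐ[ℂ] (H →L[ℂ] H)) :
    ∃ τ : A → ℝ≥0∞,
      (∀ a b : A, 0 ≤ a → 0 ≤ b → τ (a + b) = τ a + τ b) ∧
      (∀ (t : ℝ) (a : A), 0 < t → 0 ≤ a → τ (t • a) = ENNReal.ofReal t * τ a) ∧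
      τ 0 = 0 ∧
      LowerSemicontinuousOn τ {a : A | 0 ≤ a} ∧
      (∀ x : A, τ (star x * x) = τ (x * star x)) ∧
      ∀ x : A, τ (star x * x) = ∑' i, ENNReal.ofReal (‖ρ x (e i)‖ ^ 2) := by
  have hsq (x : A) (v : H) : (⟪v, ρ (star x * x) v⟫_ℂ).re = ‖ρ x v‖ ^ 2 := by
    rw [map_mul, map_star, ContinuousLinearMap.star_eq_adjoint, mul_apply_eq_comp,
      ContinuousLinearMap.adjoint_inner_right, inner_self_eq_norm_sq_to_K]
    simp [← Complex.ofReal_pow]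
  have hnonneg {a : A} (ha : 0 ≤ a) (v : H) : 0 ≤ (⟪v, ρ a v⟫_ℂ).re := by
    obtain ⟨x, rfl⟩ := CStarAlgebra.nonneg_iff_eq_star_mul_self.mp ha
    rw [hsq]
    positivity
  have hτ (x : A) : ∑' i, ENNReal.ofReal (⟪e i, ρ (star x * x) (e i)⟫_ℂ).re =
      ∑' i, ENNReal.ofReal (‖ρ x (e i)‖ ^ 2) := by simp_rw [hsq]
  refine ⟨fun a ↦ ∑' i, ENNReal.ofReal (⟪e i, ρ a (e i)⟫_ℂ).re, fun a b ha hb ↦ ?_,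
    fun t a ht ha ↦ ?_, by simp, ?_, fun x ↦ ?_, hτ⟩
  · simp only [map_add, add_apply, inner_add_right, Complex.add_re]
    rw [← ENNReal.tsum_add]
    exact tsum_congr fun i ↦ ENNReal.ofReal_add (hnonneg ha _) (hnonneg hb _)
  · beta_reduce
    rw [← Complex.coe_smul, map_smul, ← ENNReal.tsum_mul_left]
    refine tsum_congr fun i ↦ ?_
    rw [← ENNReal.ofReal_mul ht.le]
    simp
  · refine lowerSemicontinuousOn_tsum fun i ↦
      (Continuous.lowerSemicontinuous ?_).lowerSemicontinuousOn _
    have hρ : Continuous ρ := map_continuous ρ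
    exact ENNReal.continuous_ofReal.comp (by fun_prop)
  · have h := hτ (star x)
    rw [star_star] at h
    simp only [hτ, h, map_star, ContinuousLinearMap.star_eq_adjoint]
    exact e.tsum_ofReal_norm_sq_eq_adjoint e (ρ x)

/-- A hereditary star-subalgebra is stable under compression by its self-adjoint elements. -/
lemma NonUnitalStarSubalgebra.conj_mem_of_hereditary {A : Type*} [NonUnitalCStarAlgebra A]
    [PartialOrder A] [StarOrderedRing A] {B : NonUnitalStarSubalgebra ℂ A}
    (hB : ∀ a b : A, b ∈ B → 0 ≤ a → a ≤ b → a ∈ B) {d : A} (hd : d ∈ B)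
    (hsa : IsSelfAdjoint d) (a : A) : d * a * d ∈ B := by
  have ha : a ∈ Submodule.span ℂ {a : A | 0 ≤ a} := by simp [CStarAlgebra.span_nonneg]
  induction ha using Submodule.span_induction with
  | mem a ha =>
    have ha : 0 ≤ a := ha
    refine hB _ (‖a‖ • (d * d)) ?_ (hsa.conjugate_nonneg ha) ?_
    · rw [← Complex.coe_smul]
      exact SMulMemClass.smul_mem _ (mul_mem hd hd)
    · simpa [hsa.star_eq] using CStarAlgebra.star_left_conjugate_le_norm_smul (a := d) (b := a)
  | zero => simp
  | add x y _ _ hx hy => simpa [mul_add, add_mul] using add_mem hx hy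
  | smul c x _ hx => simpa [mul_smul_comm, smul_mul_assoc] using SMulMemClass.smul_mem c hx

open scoped ComplexOrder in
/-- A matrix representation of a hereditary C*-subalgebra, compressed by an element `d` acting as
the identity, induces a positive functional on the ambient algebra. -/
lemma exists_positiveLinearMap_of_hereditary {A : Type*} [NonUnitalCStarAlgebra A]
    [PartialOrder A] [StarOrderedRing A] {B : NonUnitalStarSubalgebra ℂ A}
    (hcl : IsClosed (B : Set A)) (hB : ∀ a b : A, b ∈ B → 0 ≤ a → a ≤ b → a ∈ B)
    {κ : Type*} [Fintype κ] [DecidableEq κ] [Nonempty κ] (π : B →⋆ₙₐ[ℂ] Matrix κ κ ℂ)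
    (hπ : Function.Surjective π) :
    ∃ (f : A →ₚ[ℂ] ℂ) (d : A) (L : A →ₗ[ℂ] EuclideanSpace ℂ κ),
      (∀ a, f (star (d * a) * (d * a)) = (‖L a‖ ^ 2 : ℝ)) ∧ L ≠ 0 := by
  obtain ⟨x, hx⟩ := hπ 1
  obtain ⟨i⟩ := ‹Nonempty κ›
  set d : B := star x * x with hd_def
  have hd : π d = 1 := by simp [hd_def, map_mul, map_star, hx]
  have hdsa : IsSelfAdjoint (d : A) := by simp [hd_def]
  have hmem := B.conj_mem_of_hereditary hB d.2 hdsa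
  let c : A →ₗ[ℂ] B :=
    { toFun a := ⟨d * a * d, hmem a⟩
      map_add' a b := by ext; simp [mul_add, add_mul]
      map_smul' r a := by ext; simp [mul_smul_comm, smul_mul_assoc] }
  let M : A →ₗ[ℂ] Matrix κ κ ℂ :=
    { toFun a := π (c a)
      map_add' a b := by simp
      map_smul' r a := by simp }
  have hentry (y : B) : π (star y * y) i i = (∑ j, ‖π y j i‖ ^ 2 : ℝ) := by
    simp [map_mul, map_star, Matrix.mul_apply, Matrix.star_apply, ← Complex.normSq_eq_conj_mul_self,
      Complex.normSq_eq_norm_sq]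
  let φ : A →ₗ[ℂ] ℂ := Matrix.entryLinearMap ℂ ℂ i i ∘ₗ M
  have hφ (a : A) : φ a = π (c a) i i := rfl
  have hpos (a : A) (ha : 0 ≤ a) : 0 ≤ φ a := by
    have hda : 0 ≤ (d * a * d : A) := hdsa.conjugate_nonneg ha
    have hs : CFC.sqrt (d * a * d : A) ∈ B := by
      rw [CFC.sqrt_eq_real_sqrt _ hda]
      exact cfcₙ_mem _ (hmem a)
    have h : c a = star (⟨_, hs⟩ : B) * ⟨_, hs⟩ := by
      ext
      simp [c, (CFC.sqrt_nonneg (d * a * d : A)).isSelfAdjoint.star_eq,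
        CFC.sqrt_mul_sqrt_self _ hda]
    rw [hφ, h, hentry]
    exact_mod_cast Finset.sum_nonneg fun j _ ↦ by positivity
  let L : A →ₗ[ℂ] EuclideanSpace ℂ κ :=
    { toFun a := WithLp.toLp 2 fun j ↦ M a j i
      map_add' a b := by ext; simp
      map_smul' r a := by ext; simp }
  refine ⟨PositiveLinearMap.mk₀ φ hpos, d, L, fun a ↦ ?_, fun h ↦ ?_⟩
  · have h : c (star (d * a) * (d * a)) = star (c a) * c a := by
      ext
      simp [c, hdsa.star_eq, mul_assoc]
    change φ _ = _
    rw [hφ, h, hentry, EuclideanSpace.norm_sq_eq]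
    rfl
  · have h : M d i i = 0 := congrArg (fun g : A →ₗ[ℂ] EuclideanSpace ℂ κ ↦ g d i) h
    have hc : c d = d * d * d := rfl
    simp [M, hc, hd] at h

open UniformSpace in
open scoped ComplexOrder in
/-- If `x ↦ d * x` is implemented on the pre-GNS space of `f` by a map to a finite-dimensional
space, then `d` acts on the GNS space as a nonzero Hilbert–Schmidt operator. -/
lemma PositiveLinearMap.tsum_gns_norm_sq_pos_and_lt_top {A κ ι : Type*} [NonUnitalCStarAlgebra A]
    [PartialOrder A] [StarOrderedRing A] [Fintype κ] (f : A →ₚ[ℂ] ℂ) (d : A)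
    (L : A →ₗ[ℂ] EuclideanSpace ℂ κ)
    (hL : ∀ a, f (star (d * a) * (d * a)) = (‖L a‖ ^ 2 : ℝ)) (hL0 : L ≠ 0)
    (e : HilbertBasis ι ℂ f.GNS) :
    0 < ∑' i, ENNReal.ofReal (‖f.gnsNonUnitalStarAlgHom d (e i)‖ ^ 2) ∧
      ∑' i, ENNReal.ofReal (‖f.gnsNonUnitalStarAlgHom d (e i)‖ ^ 2) < ∞ := by
  classical
  have hnorm (x : f.PreGNS) : ‖L (f.ofPreGNS x)‖ = ‖f.leftMulMapPreGNS d x‖ := by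
    rw [← sq_eq_sq₀ (by positivity) (by positivity)]
    exact_mod_cast ((f.preGNS_norm_sq (f.leftMulMapPreGNS d x)).trans (hL (f.ofPreGNS x))).symm
  let L₀ : f.PreGNS →L[ℂ] EuclideanSpace ℂ κ :=
    (L ∘ₗ f.ofPreGNS.toLinearMap).mkContinuous ‖f.leftMulMapPreGNS d‖ fun x ↦ by
      simpa [hnorm] using (f.leftMulMapPreGNS d).le_opNorm x
  let T : f.GNS →L[ℂ] EuclideanSpace ℂ κ := L₀.extend Completion.toComplL
  have hT (x : f.PreGNS) : T x = L (f.ofPreGNS x) :=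
    L₀.extend_eq Completion.denseRange_coe (Completion.isUniformInducing_coe _) x
  have hTnorm (v : f.GNS) : ‖f.gnsNonUnitalStarAlgHom d v‖ = ‖T v‖ := by
    induction v using Completion.induction_on with
    | hp => apply isClosed_eq <;> fun_prop
    | ih x => rw [hT, hnorm, gnsNonUnitalStarAlgHom_apply_coe, Completion.norm_coe]
  simp_rw [hTnorm]
  refine ⟨?_, ?_⟩
  · rw [pos_iff_ne_zero]
    intro h
    have hTe (i : ι) : T (e i) = 0 := by simpa using ENNReal.tsum_eq_zero.mp h i
    have hT0 (v : f.GNS) : T v = 0 := by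
      have := (e.hasSum_repr v).mapL T
      simp only [map_smul, hTe, smul_zero] at this
      exact this.unique hasSum_zero
    exact hL0 (LinearMap.ext fun a ↦ by simpa [hT] using hT0 (f.toPreGNS a))
  · rw [e.tsum_ofReal_norm_sq_eq_adjoint (EuclideanSpace.basisFun κ ℂ).toHilbertBasis,
      tsum_fintype]
    exact ENNReal.sum_lt_top.mpr fun _ _ ↦ ENNReal.ofReal_lt_top

/-- If a separable C*-algebra `A` admits no nontrivial lower semicontinuous
trace, then no hereditary C*-subalgebra of `A` has a finite-dimensional irreducible
representation, i.e. for every hereditary C*-subalgebra `B ⊆ A` and every `k ≥ 1` there is no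
surjective star-algebra homomorphism from `B` onto `M_k(ℂ)`. -/
theorem traceless_no_finite_dim_rep_on_hereditary {A : Type*} [NonUnitalCStarAlgebra A]
    [PartialOrder A] [StarOrderedRing A] [TopologicalSpace.SeparableSpace A]
    (htraceless : ¬ ∃ τ : A → ℝ≥0∞,
      (∀ a b : A, 0 ≤ a → 0 ≤ b → τ (a + b) = τ a + τ b) ∧
      (∀ (t : ℝ) (a : A), 0 < t → 0 ≤ a → τ (t • a) = ENNReal.ofReal t * τ a) ∧
      τ 0 = 0 ∧
      LowerSemicontinuousOn τ {a : A | 0 ≤ a} ∧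
      (∀ x : A, τ (star x * x) = τ (x * star x)) ∧
      (∃ a : A, 0 ≤ a ∧ 0 < τ a ∧ τ a < ∞)) :
    ∀ B : NonUnitalStarSubalgebra ℂ A, IsClosed (B : Set A) →
      (∀ a b : A, b ∈ B → 0 ≤ a → a ≤ b → a ∈ B) →
      ∀ k : ℕ, 1 ≤ k →
        ¬ ∃ π : B →⋆ₙₐ[ℂ] Matrix (Fin k) (Fin k) ℂ, Function.Surjective π := by
  rintro B hcl hB k hk ⟨π, hπ⟩
  have : Nonempty (Fin k) := ⟨⟨0, hk⟩⟩
  obtain ⟨f, d, L, hL, hL0⟩ := exists_positiveLinearMap_of_hereditary hcl hB π hπ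
  obtain ⟨w, e, -⟩ := exists_hilbertBasis ℂ f.GNS
  obtain ⟨τ, hadd, hsmul, hzero, hlsc, htr, hval⟩ :=
    exists_lsc_trace_of_representation e f.gnsNonUnitalStarAlgHom
  refine htraceless ⟨τ, hadd, hsmul, hzero, hlsc, htr, star d * d, star_mul_self_nonneg d, ?_⟩
  rw [hval]
  exact f.tsum_gns_norm_sq_pos_and_lt_top d L hL hL0 e
end

section
/- Let k ≥ 1 be an integer and set l = ⌈k/2⌉. Define the k×k real matrix κ_k by κ_k(i,j) = min(i, j, k+1−i, k+1−j)/(l+1) for 1 ≤ i, j ≤ k. Then κ_k is positive semidefinite, and every entry of κ_k lies in the interval (0, 1]; in particular every diagonal entry is at most l/(l+1) < 1. -/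
/-- The matrix of pairwise minima of a natural-valued function is positive semidefinite. -/
theorem Matrix.posSemidef_of_natCast_min {n : Type*} [Fintype n] (f : n → ℕ) :
    (Matrix.of fun i j => ((min (f i) (f j) : ℕ) : ℝ)).PosSemidef := by
  set N := Finset.univ.sup f
  have hsum : (Matrix.of fun i j => ((min (f i) (f j) : ℕ) : ℝ)) =
      ∑ m ∈ Finset.range N, Matrix.vecMulVec (fun i => if m < f i then (1 : ℝ) else 0)
        (star fun i => if m < f i then (1 : ℝ) else 0) := by
    ext i j
    have hi : f i ≤ N := Finset.le_sup (Finset.mem_univ i)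
    have hfilter : {m ∈ Finset.range N | m < f i ∧ m < f j} =
        Finset.range (min (f i) (f j)) := by
      ext m
      simp only [Finset.mem_filter, Finset.mem_range]
      omega
    simp only [Matrix.of_apply, Matrix.sum_apply, Matrix.vecMulVec_apply,
      star_trivial, ite_zero_mul_ite_zero, mul_one, Finset.sum_boole, hfilter, Finset.card_range]
  rw [hsum]
  exact Matrix.posSemidef_sum _ fun m _ => Matrix.posSemidef_vecMulVec_self_star _

/-- For `k ≥ 1` and `l = ⌈k/2⌉`, the `k × k` real matrix
`κ_k(i,j) = min(i, j, k+1−i, k+1−j)/(l+1)` (indices `1 ≤ i, j ≤ k`) is positive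
semidefinite, all its entries lie in `(0, 1]`, and every diagonal entry is at most
`l/(l+1) < 1`. Here `Fin k` indices are shifted by one, so the `1`-indexed `i` is `i.1 + 1`
and `k + 1 − i` becomes `k − i.1`. -/
theorem kappa_matrix_posSemidef (k : ℕ) (hk : 1 ≤ k) :
    let l : ℕ := (k + 1) / 2
    let κ : Matrix (Fin k) (Fin k) ℝ := Matrix.of fun i j =>
      ((min (min (i.1 + 1) (j.1 + 1)) (min (k - i.1) (k - j.1)) : ℕ) : ℝ) / ((l : ℝ) + 1)
    κ.PosSemidef ∧ (∀ i j, 0 < κ i j ∧ κ i j ≤ 1) ∧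
      (∀ i, κ i i ≤ (l : ℝ) / ((l : ℝ) + 1)) ∧ (l : ℝ) / ((l : ℝ) + 1) < 1 := by
  intro l κ
  have hl : (0 : ℝ) < (l : ℝ) + 1 := by positivity
  have hle : ∀ i j, κ i j ≤ (l : ℝ) / ((l : ℝ) + 1) := fun i j => by
    simp only [κ, Matrix.of_apply]
    gcongr
    omega
  have hlt : (l : ℝ) / ((l : ℝ) + 1) < 1 := (div_lt_one hl).2 (lt_add_one _)
  refine ⟨?_, fun i j => ⟨?_, (hle i j).trans hlt.le⟩, fun i => hle i i, hlt⟩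
  · have hκ : κ = ((l : ℝ) + 1)⁻¹ • Matrix.of fun i j : Fin k =>
        ((min (min (i.1 + 1) (k - i.1)) (min (j.1 + 1) (k - j.1)) : ℕ) : ℝ) := by
      ext i j
      simp only [κ, Matrix.of_apply, Matrix.smul_apply, smul_eq_mul, div_eq_inv_mul]
      rw [min_min_min_comm]
    rw [hκ]
    exact (Matrix.posSemidef_of_natCast_min fun i : Fin k => min (i.1 + 1) (k - i.1)).smul
      (inv_nonneg.2 hl.le)
  · refine div_pos (Nat.cast_pos.2 ?_) hl
    omega
end
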